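/- Let Ω be a metric space. The k-nearest neighbour classifier is universally consistent in Ω if and only if it is universally consistent in every separable metric subspace of Ω and the density of Ω is strictly less than every real-valued measurable cardinal. -/

import Mathlib

open MeasureTheory Filter Set Metric Cardinal
open scoped ENNReal

noncomputable section

universe u

/-- A cardinal `τ` is *real-valued measurable* if a set of cardinality `τ` carries a
probability measure defined on *all* subsets, vanishing on singletons, whose ideal of
null sets is closed under unions of fewer than `τ` members. -/
def IsRealValuedMeasurableCardinal (τ : Cardinal.{u}) : Prop :=
  ∃ μ : @Measure τ.out ⊤,
    μ Set.univ = 1 ∧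
    (∀ x : τ.out, μ {x} = 0) ∧
    ∀ 𝒩 : Set (Set τ.out), #𝒩 < τ → (∀ A ∈ 𝒩, μ A = 0) → μ (⋃₀ 𝒩) = 0

/-- The density of a topological space: the least cardinality of a dense subset. -/
def densityCard (X : Type u) [TopologicalSpace X] : Cardinal.{u} :=
  sInf {c : Cardinal.{u} | ∃ s : Set X, Dense s ∧ #s = c}

/-- The label assigned to the point `x` by the `k`-nearest-neighbour rule on the labelled
sample `σ`, distance ties being broken according to the ordering `π` of the sample, and
voting ties broken in favour of the label `1` (`true`).  An index `i` is among the `k`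
nearest neighbours of `x` iff fewer than `k` indices precede it in the lexicographic
order (distance to `x`, position under `π`). -/
def kNNLabel {Ω : Type u} [MetricSpace Ω] (n k : ℕ) (σ : Fin n → Ω × Bool)
    (π : Equiv.Perm (Fin n)) (x : Ω) : Bool :=
  let nearer : Fin n → Fin n → Prop := fun j i =>
    dist x (σ j).1 < dist x (σ i).1 ∨ (dist x (σ j).1 = dist x (σ i).1 ∧ π j < π i)
  let S : Set (Fin n) := {i | Set.ncard {j | nearer j i} < k}
  decide (k ≤ 2 * Set.ncard {i ∈ S | (σ i).2 = true})

/-- The expected misclassification error of the `k`-nearest neighbour rule at sample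
size `n`, for i.i.d. data with law `μt`, the tie-breaking order of the sample being
chosen uniformly at random among all `n!` orderings. -/
def kNNError {Ω : Type u} [MetricSpace Ω] [MeasurableSpace Ω]
    (μt : Measure (Ω × Bool)) (n k : ℕ) : ℝ≥0∞ :=
  (∑ π : Equiv.Perm (Fin n),
      (Measure.pi fun _ : Fin n => μt).prod μt
        {q : (Fin n → Ω × Bool) × (Ω × Bool) | kNNLabel n k q.1 π q.2.1 ≠ q.2.2}) /
    (Nat.factorial n : ℝ≥0∞)

/-- The Bayes (optimal) error of the learning problem given by a probability measure on
`Ω × {0,1}`: the infimum of the misclassification errors of all measurable classifiers. -/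
def bayesError {Ω : Type u} [MeasurableSpace Ω] (μt : Measure (Ω × Bool)) : ℝ≥0∞ :=
  ⨅ (T : Ω → Bool) (_ : Measurable T), μt {p : Ω × Bool | T p.1 ≠ p.2}

/-- The `k`-nearest neighbour classifier is universally consistent in the metric space `Ω`
(with its Borel sigma-algebra): for every choice of `k = kₙ` with `kₙ → ∞` and `kₙ/n → 0`
and every probability measure `μ̃` on `Ω × {0,1}`, the expected misclassification error at
sample size `n` converges to the Bayes error of `μ̃`. -/
def kNNUniversallyConsistent (Ω : Type u) [MetricSpace Ω] : Prop :=
  letI : MeasurableSpace Ω := borel Ω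
  ∀ k : ℕ → ℕ, Tendsto k atTop atTop →
    Tendsto (fun n : ℕ => (k n : ℝ) / n) atTop (nhds 0) →
    ∀ μt : Measure (Ω × Bool), IsProbabilityMeasure μt →
      Tendsto (fun n : ℕ => kNNError μt n (k n)) atTop (nhds (bayesError μt))

theorem exists_max_pairwise {X : Type*} (r : X → X → Prop) (B : Set X) :
    ∃ S : Set X, S ⊆ B ∧ S.Pairwise r ∧ ∀ x ∈ B, x ∉ S → ∃ y ∈ S, ¬ r x y ∨ ¬ r y x := by
  obtain ⟨S, hS⟩ := zorn_subset {S : Set X | S ⊆ B ∧ S.Pairwise r} (by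
    intro c hc hch
    refine ⟨⋃₀ c, ⟨sUnion_subset fun s hs => (hc hs).1, ?_⟩, fun s hs => subset_sUnion_of_mem hs⟩
    exact (pairwise_sUnion hch.directedOn).2 fun s hs => (hc hs).2)
  refine ⟨S, hS.prop.1, hS.prop.2, fun x hxB hx => ?_⟩
  by_contra hcon
  push Not at hcon
  have : insert x S ∈ {S : Set X | S ⊆ B ∧ S.Pairwise r} := by
    refine ⟨insert_subset hxB hS.prop.1, ?_⟩
    exact hS.prop.2.insert fun y hy _ => hcon y hy
  exact hx (hS.le_of_ge this (subset_insert x S) (mem_insert x S))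

/-- combinatorial core of the k-NN label -/
def kNNcore (n k : ℕ) (π : Equiv.Perm (Fin n)) (M : Fin n → Fin n → Prop) (y : Fin n → Bool) : Bool :=
  let nearer : Fin n → Fin n → Prop := fun j i => M j i ∨ ((¬ M j i ∧ ¬ M i j) ∧ π j < π i)
  let S : Set (Fin n) := {i | Set.ncard {j | nearer j i} < k}
  decide (k ≤ 2 * Set.ncard {i ∈ S | y i = true})

theorem kNNLabel_eq_core {Ω : Type u} [MetricSpace Ω] (n k : ℕ) (σ : Fin n → Ω × Bool)
    (π : Equiv.Perm (Fin n)) (x : Ω) :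
    kNNLabel n k σ π x =
      kNNcore n k π (fun j i => dist x (σ j).1 < dist x (σ i).1) (fun i => (σ i).2) := by
  have h : ∀ i j, (dist x (σ j).1 = dist x (σ i).1) ↔
      (¬ dist x (σ j).1 < dist x (σ i).1 ∧ ¬ dist x (σ i).1 < dist x (σ j).1) := by
    intro i j
    rw [not_lt, not_lt, le_antisymm_iff, and_comm]
  simp only [kNNLabel, kNNcore, h]

theorem prod_ge_of_slices {X Y : Type*} [MeasurableSpace X] [MeasurableSpace Y] (μ : Measure X)
    (ν : Measure Y) [IsProbabilityMeasure μ] [SFinite ν] (S : Set (X × Y)) (c : ℝ≥0∞)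
    (h : ∀ x, c ≤ ν {y | (x, y) ∈ S}) : c ≤ μ.prod ν S := by
  rw [← measure_toMeasurable, Measure.prod_apply (measurableSet_toMeasurable _ _)]
  calc c = ∫⁻ _, c ∂μ := by simp
    _ ≤ ∫⁻ x, ν (Prod.mk x ⁻¹' toMeasurable (μ.prod ν) S) ∂μ :=
        lintegral_mono fun x => (h x).trans
          (measure_mono fun y hy => subset_toMeasurable (μ.prod ν) S hy)

theorem kNNError_ge {Ω : Type u} [MetricSpace Ω] [MeasurableSpace Ω] {L : Type*} [MeasurableSpace L]
    (ρ : Measure L) [IsProbabilityMeasure ρ] (j : L → Ω × Bool) (hj : Measurable j) (n k : ℕ)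
    (c : ℝ≥0∞) (h : ∀ (π : Equiv.Perm (Fin n)) (σ : Fin n → L),
      c ≤ ρ {x | kNNLabel n k (fun i => j (σ i)) π (j x).1 ≠ (j x).2}) :
    c ≤ kNNError (ρ.map j) n k := by
  have : IsProbabilityMeasure (ρ.map j) := Measure.isProbabilityMeasure_map hj.aemeasurable
  have mp : MeasurePreserving j ρ (ρ.map j) := ⟨hj, rfl⟩
  have mp2 := (measurePreserving_pi (fun _ : Fin n => ρ) (fun _ => ρ.map j) (fun _ => mp)).prod mp
  unfold kNNError
  have key : ∀ π : Equiv.Perm (Fin n), c ≤ (Measure.pi fun _ : Fin n => ρ.map j).prod (ρ.map j)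
        {q : (Fin n → Ω × Bool) × (Ω × Bool) | kNNLabel n k q.1 π q.2.1 ≠ q.2.2} := by
    intro π
    rw [← mp2.map_eq]
    refine le_trans ?_ (Measure.le_map_apply mp2.measurable.aemeasurable _)
    refine prod_ge_of_slices _ _ _ _ fun σ => ?_
    exact h π σ
  rw [ENNReal.le_div_iff_mul_le (by left; exact_mod_cast (Nat.factorial_pos n).ne') (by left; simp)]
  calc c * (n.factorial : ℝ≥0∞) = ∑ _π : Equiv.Perm (Fin n), c := by
        simp [Fintype.card_perm, mul_comm]
    _ ≤ _ := Finset.sum_le_sum fun π _ => key π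

theorem bayes_zero {Ω : Type u} [MeasurableSpace Ω] {L : Type*} [MeasurableSpace L]
    (ρ : Measure L) (j : L → Ω × Bool) (hj : Measurable j) (T : Ω → Bool) (hT : Measurable T)
    (h : ∀ x, T (j x).1 = (j x).2) : bayesError (ρ.map j) = 0 := by
  refine le_antisymm ?_ bot_le
  refine (iInf₂_le T hT).trans ?_
  have hm : MeasurableSet {p : Ω × Bool | T p.1 ≠ p.2} :=
    (measurableSet_eq_fun (hT.comp measurable_fst) measurable_snd).compl
  rw [Measure.map_apply hj hm]
  have : j ⁻¹' {p : Ω × Bool | T p.1 ≠ p.2} = ∅ := by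
    ext x; simp [h]
  simp [this]

theorem consistent_iff {Ω : Type u} [MetricSpace Ω] [mΩ : MeasurableSpace Ω] [b : BorelSpace Ω] :
    kNNUniversallyConsistent Ω ↔ ∀ k : ℕ → ℕ, Tendsto k atTop atTop →
    Tendsto (fun n : ℕ => (k n : ℝ) / n) atTop (nhds 0) →
    ∀ μt : Measure (Ω × Bool), IsProbabilityMeasure μt →
      Tendsto (fun n : ℕ => kNNError μt n (k n)) atTop (nhds (bayesError μt)) := by
  have := b.measurable_eq
  subst this
  rfl

/-- Consequence of universal consistency. -/
theorem consistent_approx {Ω : Type u} [MetricSpace Ω] [MeasurableSpace Ω] [BorelSpace Ω]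
    (hc : kNNUniversallyConsistent Ω) {L : Type*} [MeasurableSpace L]
    (ρ : Measure L) [IsProbabilityMeasure ρ] (j : L → Ω × Bool) (hj : Measurable j)
    (T : Ω → Bool) (hT : Measurable T) (h : ∀ x, T (j x).1 = (j x).2) (ε : ℝ≥0∞) (hε : 0 < ε) :
    ∃ (n k : ℕ) (π : Equiv.Perm (Fin n)) (σ : Fin n → L),
      ρ {x | kNNLabel n k (fun i => j (σ i)) π (j x).1 ≠ (j x).2} < ε := by
  have : IsProbabilityMeasure (ρ.map j) := Measure.isProbabilityMeasure_map hj.aemeasurable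
  have h1 : Tendsto (fun n => Nat.sqrt n) atTop atTop := by
    refine tendsto_atTop.2 fun b => ?_
    filter_upwards [eventually_ge_atTop (b * b)] with n hn
    exact Nat.le_sqrt.2 hn
  have h2 : Tendsto (fun n : ℕ => (Nat.sqrt n : ℝ) / n) atTop (nhds 0) := by
    have h3 : Tendsto (fun n : ℕ => ((Nat.sqrt n : ℕ) : ℝ)⁻¹) atTop (nhds 0) :=
      tendsto_inv_atTop_zero.comp (tendsto_natCast_atTop_atTop.comp h1)
    refine squeeze_zero' (Eventually.of_forall fun n => by positivity) ?_ h3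
    filter_upwards [eventually_ge_atTop 1] with n hn
    have hs : 0 < Nat.sqrt n := Nat.sqrt_pos.2 hn
    have hs' : (0 : ℝ) < Nat.sqrt n := by exact_mod_cast hs
    rw [div_le_iff₀ (by exact_mod_cast hn), inv_mul_eq_div, le_div_iff₀ hs']
    exact_mod_cast Nat.sqrt_le n
  have h3 := consistent_iff.1 hc _ h1 h2 (ρ.map j) this
  rw [bayes_zero ρ j hj T hT h] at h3
  obtain ⟨n, hn⟩ := (h3.eventually (gt_mem_nhds hε)).exists
  by_contra hcon
  push Not at hcon
  exact absurd (kNNError_ge ρ j hj n (Nat.sqrt n) ε (hcon n (Nat.sqrt n))) (not_le.2 hn)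

def dApprox {Ω : Type u} [MetricSpace Ω] (D : Set Ω) (x y : Ω) : ℝ≥0∞ :=
  ⨅ z : D, edist x z + edist (z : Ω) y

theorem dApprox_eq {Ω : Type u} [MetricSpace Ω] (D : Set Ω) (x y : Ω) (hx : x ∈ closure D) :
    dApprox D x y = edist x y := by
  apply le_antisymm
  · refine ENNReal.le_of_forall_pos_le_add fun ε hε _ => ?_
    obtain ⟨z, hz, hxz⟩ := EMetric.mem_closure_iff.1 hx (ε / 2 : ℝ≥0∞) (by
      simpa using hε.ne')
    refine (iInf_le _ ⟨z, hz⟩).trans ?_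
    calc edist x z + edist z y ≤ edist x z + (edist z x + edist x y) := by
          gcongr; exact edist_triangle _ _ _
      _ = edist x y + (edist x z + edist x z) := by rw [edist_comm z x]; ring
      _ ≤ edist x y + (ε / 2 + ε / 2) := by gcongr
      _ = edist x y + ε := by rw [ENNReal.add_halves]
  · exact le_iInf fun z => edist_triangle _ _ _

theorem measurable_dApprox {Ω : Type u} [MetricSpace Ω] [MeasurableSpace Ω] [BorelSpace Ω]
    (D : Set Ω) (hD : D.Countable) : Measurable (fun p : Ω × Ω => dApprox D p.1 p.2) := by
  have := hD.to_subtype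
  unfold dApprox
  refine Measurable.iInf fun z => ?_
  refine Measurable.add ?_ ?_
  · exact (continuous_id.edist continuous_const |>.measurable : Measurable fun x : Ω => edist x (z : Ω)).comp
      measurable_fst
  · exact (continuous_const.edist continuous_id |>.measurable : Measurable fun x : Ω => edist (z : Ω) x).comp
      measurable_snd

def errSet {Ω : Type u} [MetricSpace Ω] (D : Set Ω) (n k : ℕ) (π : Equiv.Perm (Fin n)) :
    Set ((Fin n → Ω × Bool) × (Ω × Bool)) :=
  {q | kNNcore n k π (fun j i => dApprox D q.2.1 (q.1 j).1 < dApprox D q.2.1 (q.1 i).1)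
    (fun i => (q.1 i).2) ≠ q.2.2}

theorem measurableSet_errSet {Ω : Type u} [MetricSpace Ω] [MeasurableSpace Ω] [BorelSpace Ω]
    (D : Set Ω) (hD : D.Countable) (n k : ℕ) (π : Equiv.Perm (Fin n)) :
    MeasurableSet (errSet D n k π) := by
  have hd := measurable_dApprox D hD
  have h1 : Measurable (fun q : (Fin n → Ω × Bool) × (Ω × Bool) =>
      ((fun (j i : Fin n) => dApprox D q.2.1 (q.1 j).1 < dApprox D q.2.1 (q.1 i).1 : 
        Fin n → Fin n → Prop), (fun i => (q.1 i).2 : Fin n → Bool))) := by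
    refine Measurable.prodMk ?_ ?_
    · refine measurable_pi_lambda _ fun j => measurable_pi_lambda _ fun i => ?_
      have hj : ∀ j : Fin n, Measurable (fun q : (Fin n → Ω × Bool) × (Ω × Bool) =>
          dApprox D q.2.1 (q.1 j).1) := fun j =>
        hd.comp (f := fun q : (Fin n → Ω × Bool) × (Ω × Bool) => (q.2.1, (q.1 j).1)) (by fun_prop)
      exact Measurable.lt (hj j) (hj i)
    · fun_prop
  have h2 : Measurable (fun p : (Fin n → Fin n → Prop) × (Fin n → Bool) => kNNcore n k π p.1 p.2) :=
    Measurable.of_discrete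
  exact (measurableSet_eq_fun (h2.comp h1) (by fun_prop)).compl

theorem edist_lt_edist' {Ω : Type u} [MetricSpace Ω] (x y z : Ω) :
    edist x y < edist x z ↔ dist x y < dist x z := by
  rw [edist_dist, edist_dist]
  exact ENNReal.ofReal_lt_ofReal_iff_of_nonneg dist_nonneg

theorem mem_errSet {Ω : Type u} [MetricSpace Ω] (D : Set Ω) (n k : ℕ) (π : Equiv.Perm (Fin n))
    (q : (Fin n → Ω × Bool) × (Ω × Bool)) (hq : q.2.1 ∈ closure D) :
    q ∈ errSet D n k π ↔ kNNLabel n k q.1 π q.2.1 ≠ q.2.2 := by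
  rw [kNNLabel_eq_core]
  simp only [errSet, mem_ofPred_eq, dApprox_eq D _ _ hq, edist_lt_edist']

theorem kNNError_map {Ω : Type u} [MetricSpace Ω] [MeasurableSpace Ω] [BorelSpace Ω] (Y : Set Ω)
    (hY : TopologicalSpace.IsSeparable Y) (νt : Measure (Y × Bool)) [IsProbabilityMeasure νt]
    (n k : ℕ) :
    kNNError (νt.map (Prod.map Subtype.val id)) n k = kNNError νt n k := by
  obtain ⟨D, hD, hYD⟩ := hY
  set j : Y × Bool → Ω × Bool := Prod.map Subtype.val id with hjdef
  have hj : Measurable j := by fun_prop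
  have : IsProbabilityMeasure (νt.map j) := Measure.isProbabilityMeasure_map hj.aemeasurable
  have mp : MeasurePreserving j νt (νt.map j) := ⟨hj, rfl⟩
  have mp2 := (measurePreserving_pi (fun _ : Fin n => νt) (fun _ => νt.map j) (fun _ => mp)).prod mp
  unfold kNNError
  congr 1
  refine Finset.sum_congr rfl fun π _ => ?_
  rw [← mp2.map_eq]
  have hmZ : MeasurableSet {q : (Fin n → Ω × Bool) × (Ω × Bool) | q.2.1 ∈ closure D} :=
    (isClosed_closure.measurableSet).preimage (by fun_prop)
  have hpre : ∀ p : (Fin n → Y × Bool) × (Y × Bool),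
      (Prod.map (fun a i => j (a i)) j p).2.1 ∈ closure D := fun p => hYD p.2.1.2
  have hae : (errSet D n k π : Set _) =ᵐ[Measure.map (Prod.map (fun a i => j (a i)) j)
      ((Measure.pi fun _ : Fin n => νt).prod νt)]
      {q : (Fin n → Ω × Bool) × (Ω × Bool) | kNNLabel n k q.1 π q.2.1 ≠ q.2.2} := by
    have : ∀ᵐ q ∂(Measure.map (Prod.map (fun a i => j (a i)) j)
      ((Measure.pi fun _ : Fin n => νt).prod νt)),
        q ∈ {q : (Fin n → Ω × Bool) × (Ω × Bool) | q.2.1 ∈ closure D} := by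
      refine (ae_map_iff mp2.measurable.aemeasurable hmZ).2 ?_
      exact Eventually.of_forall hpre
    filter_upwards [this] with q hq
    exact propext (mem_errSet D n k π q hq)
  rw [← measure_congr hae, Measure.map_apply mp2.measurable (measurableSet_errSet D hD n k π)]
  congr 1
  ext p
  rw [mem_preimage, mem_errSet D n k π _ (hpre p)]
  rw [mem_ofPred_eq, kNNLabel_eq_core, kNNLabel_eq_core]
  rfl

theorem bayesError_map {Ω : Type u} [MetricSpace Ω] [MeasurableSpace Ω] [BorelSpace Ω] (Y : Set Ω)
    (νt : Measure (Y × Bool)) :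
    bayesError (νt.map (Prod.map Subtype.val id)) = bayesError νt := by
  set j : Y × Bool → Ω × Bool := Prod.map Subtype.val id with hjdef
  have hj : Measurable j := by fun_prop
  have hm : ∀ T : Ω → Bool, Measurable T → MeasurableSet {p : Ω × Bool | T p.1 ≠ p.2} :=
    fun T hT => (measurableSet_eq_fun (hT.comp measurable_fst) measurable_snd).compl
  unfold bayesError
  apply le_antisymm
  · refine le_iInf₂ fun T hT => ?_
    obtain ⟨B, hB, hBT⟩ : ∃ B : Set Ω, MeasurableSet B ∧ Subtype.val ⁻¹' B = T ⁻¹' {true} :=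
      hT (measurableSet_singleton true)
    classical
    have hT' : Measurable (fun x => decide (x ∈ B)) := by
      refine measurable_to_bool ?_
      have : (fun x => decide (x ∈ B)) ⁻¹' {true} = B := by ext; simp
      rwa [this]
    refine (iInf₂_le _ hT').trans ?_
    rw [Measure.map_apply hj (hm _ hT')]
    refine measure_mono fun p hp => ?_
    have h1 : (p.1 : Ω) ∈ B ↔ T p.1 = true := by
      have : p.1 ∈ Subtype.val ⁻¹' B ↔ p.1 ∈ T ⁻¹' {true} := by rw [hBT]
      simpa using this
    simp only [hjdef, mem_preimage, mem_ofPred_eq, Prod.map_fst, Prod.map_snd, id, h1] at hp ⊢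
    simpa using hp
  · refine le_iInf₂ fun T hT => ?_
    refine (iInf₂_le (T ∘ Subtype.val) (hT.comp measurable_subtype_coe)).trans ?_
    rw [Measure.map_apply hj (hm _ hT)]
    exact le_rfl

/-- Consistency descends to separable subspaces. -/
theorem consistent_subspace {Ω : Type u} [MetricSpace Ω] (hc : kNNUniversallyConsistent Ω) (Y : Set Ω)
    (hY : TopologicalSpace.IsSeparable Y) : kNNUniversallyConsistent Y := by
  borelize Ω
  rw [consistent_iff] at hc ⊢
  intro k h1 h2 νt hν
  have hj : Measurable (Prod.map Subtype.val id : Y × Bool → Ω × Bool) := by fun_prop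
  have := hc k h1 h2 (νt.map (Prod.map Subtype.val id))
    (Measure.isProbabilityMeasure_map hj.aemeasurable)
  simpa only [kNNError_map Y hY, bayesError_map] using this

/-- Consistency ascends if all measures have separable support. -/
theorem consistent_of_support {Ω : Type u} [MetricSpace Ω] [MeasurableSpace Ω] [BorelSpace Ω]
    (hs : ∀ Y : Set Ω, TopologicalSpace.IsSeparable Y → kNNUniversallyConsistent Y)
    (hsupp : ∀ μ : Measure Ω, IsProbabilityMeasure μ →
      ∃ Y : Set Ω, IsClosed Y ∧ TopologicalSpace.IsSeparable Y ∧ μ Yᶜ = 0) :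
    kNNUniversallyConsistent Ω := by
  rw [consistent_iff]
  intro k h1 h2 μt hμ
  obtain ⟨Y, hYc, hYs, hY0⟩ := hsupp (μt.map Prod.fst)
    (Measure.isProbabilityMeasure_map measurable_fst.aemeasurable)
  have hj : MeasurableEmbedding (Prod.map Subtype.val id : Y × Bool → Ω × Bool) :=
    (MeasurableEmbedding.subtype_coe hYc.measurableSet).prodMap MeasurableEmbedding.id
  set νt := μt.comap (Prod.map Subtype.val id : Y × Bool → Ω × Bool) with hνt
  have hmap : νt.map (Prod.map Subtype.val id) = μt := by
    rw [hνt, hj.map_comap]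
    rw [Measure.map_apply measurable_fst hYc.measurableSet.compl] at hY0
    refine Measure.restrict_eq_self_of_ae_mem ?_
    refine measure_mono_null (fun p hp => ?_) hY0
    intro hp'
    simp only [mem_compl_iff] at hp
    exact hp ⟨(⟨p.1, hp'⟩, p.2), rfl⟩
  have hν : IsProbabilityMeasure νt := by
    constructor
    rw [← preimage_univ (f := (Prod.map Subtype.val id : Y × Bool → Ω × Bool)),
      ← hj.map_apply, hmap, measure_univ]
  have := consistent_iff.1 (hs Y hYs) k h1 h2 νt hν
  rw [← hmap]
  simpa only [kNNError_map Y hYs, bayesError_map] using this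

theorem rvm_of_measure {X : Type u} [mX : MeasurableSpace X] [DiscreteMeasurableSpace X]
    (m : Measure X) [IsFiniteMeasure m]
    (h0 : m Set.univ ≠ 0) (hs : ∀ x, m {x} = 0) :
    ∃ τ : Cardinal.{u}, IsRealValuedMeasurableCardinal τ ∧ τ ≤ #X := by
  set C : Set Cardinal.{u} := {c | ∃ ι : Type u, #ι = c ∧ ∃ N : ι → Set X,
    (∀ i, m (N i) = 0) ∧ m (⋃ i, N i) ≠ 0} with hC
  have hX : #X ∈ C := ⟨X, rfl, fun x => {x}, hs, by rw [iUnion_of_singleton]; exact h0⟩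
  have hmin : ∀ (ι : Type u) (N : ι → Set X), #ι < sInf C → (∀ i, m (N i) = 0) →
      m (⋃ i, N i) = 0 := by
    intro ι N hlt hN
    by_contra hne
    exact notMem_of_lt_csInf hlt (OrderBot.bddBelow _) ⟨ι, rfl, N, hN, hne⟩
  refine ⟨sInf C, ?_, csInf_le (OrderBot.bddBelow _) hX⟩
  obtain ⟨ι, hι, N₀, hN₀, hne₀⟩ := csInf_mem (s := C) ⟨_, hX⟩
  generalize sInf C = τ at *
  have e : τ.out ≃ ι := Classical.choice (Cardinal.eq.1 (by rw [Cardinal.mk_out, hι]))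
  set N : τ.out → Set X := fun i => N₀ (e i) with hNdef
  have hN : ∀ i, m (N i) = 0 := fun i => hN₀ _
  have hU : ⋃ i, N i = ⋃ i, N₀ i := e.surjective.iUnion_comp N₀
  have hne : m (⋃ i, N i) ≠ 0 := by rwa [hU]
  have : Nonempty τ.out := by
    by_contra hemp
    rw [not_nonempty_iff] at hemp
    exact hne (by simp)
  have hp : ∀ x, ∃ i : τ.out, x ∈ (⋃ i, N i) → x ∈ N i := by
    intro x
    by_cases hx : x ∈ ⋃ i, N i
    · obtain ⟨i, hi⟩ := mem_iUnion.1 hx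
      exact ⟨i, fun _ => hi⟩
    · exact ⟨Classical.arbitrary _, fun h => absurd h hx⟩
  choose p hp using hp
  let _ : MeasurableSpace τ.out := ⊤
  have hpm : Measurable p := Measurable.of_discrete
  set U := ⋃ i, N i with hUdef
  refine ⟨(m U)⁻¹ • (m.restrict U).map p, ?_, ?_, ?_⟩
  · rw [Measure.smul_apply, Measure.map_apply hpm MeasurableSet.univ]
    simp [ENNReal.inv_mul_cancel hne (measure_ne_top m U)]
  · intro i
    rw [Measure.smul_apply, Measure.map_apply hpm trivial, Measure.restrict_apply MeasurableSet.of_discrete]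
    have : m (p ⁻¹' {i} ∩ U) = 0 := by
      refine measure_mono_null ?_ (hN i)
      rintro x ⟨hx, hxU⟩
      have := hp x hxU
      rwa [show p x = i from hx] at this
    simp [this]
  · intro 𝒩 hcard hnull
    rw [Measure.smul_apply, Measure.map_apply hpm trivial, Measure.restrict_apply MeasurableSet.of_discrete]
    have hinv : (m U)⁻¹ ≠ 0 := ENNReal.inv_ne_zero.2 (measure_ne_top m U)
    have h2 : m (⋃ A : 𝒩, p ⁻¹' (A : Set τ.out) ∩ U) = 0 := by
      refine hmin 𝒩 _ hcard fun A => ?_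
      have := hnull A A.2
      rw [Measure.smul_apply, Measure.map_apply hpm trivial,
        Measure.restrict_apply MeasurableSet.of_discrete, smul_eq_mul, mul_eq_zero] at this
      exact this.resolve_left hinv
    have h3 : p ⁻¹' ⋃₀ 𝒩 ∩ U = ⋃ A : 𝒩, p ⁻¹' (A : Set τ.out) ∩ U := by
      ext x
      simp only [mem_inter_iff, mem_preimage, mem_sUnion, mem_iUnion, Subtype.exists, exists_prop]
      constructor
      · rintro ⟨⟨A, hA, hx⟩, hxU⟩
        exact ⟨A, hA, hx, hxU⟩
      · rintro ⟨A, hA, hx, hxU⟩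
        exact ⟨⟨A, hA, hx⟩, hxU⟩
    rw [h3, h2]
    simp

theorem exists_sep {Ω : Type u} [MetricSpace Ω] (B : Set Ω) :
    ∃ A : ℕ → Set Ω, (∀ n, A n ⊆ B ∧ (A n).Pairwise fun x y => 1 / ((n : ℝ) + 1) ≤ dist x y) ∧
      B ⊆ closure (⋃ n, A n) := by
  have := fun n : ℕ => exists_max_pairwise (fun x y : Ω => 1 / ((n : ℝ) + 1) ≤ dist x y) B
  choose A h1 h2 h3 using this
  refine ⟨A, fun n => ⟨h1 n, h2 n⟩, fun x hx => ?_⟩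
  rw [Metric.mem_closure_iff]
  intro ε hε
  obtain ⟨n, hn⟩ := exists_nat_one_div_lt hε
  by_cases hxA : x ∈ A n
  · exact ⟨x, mem_iUnion.2 ⟨n, hxA⟩, by simpa using hε⟩
  · obtain ⟨y, hy, hxy⟩ := h3 n x hx hxA
    rw [dist_comm y x, or_self, not_le] at hxy
    exact ⟨y, mem_iUnion.2 ⟨n, hy⟩, hxy.trans hn⟩

theorem density_attained (Ω : Type u) [MetricSpace Ω] : ∃ s : Set Ω, Dense s ∧ #s = densityCard Ω :=
  csInf_mem (s := {c : Cardinal.{u} | ∃ s : Set Ω, Dense s ∧ #s = c}) ⟨_, Set.univ, dense_univ, rfl⟩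

theorem measurable_first {Ω : Type u} [MetricSpace Ω] [MeasurableSpace Ω] [BorelSpace Ω]
    {I : Type u} [LinearOrder I] (U : I → Set Ω) (hU : ∀ i, IsOpen (U i)) (J : Set I) :
    MeasurableSet (⋃ i ∈ J, {x | x ∈ U i ∧ ∀ j < i, x ∉ U j}) := by
  set V : ℕ → I → Set Ω := fun n i =>
    {x | (∀ j < i, x ∉ U j) ∧ ball x (1 / ((n : ℝ) + 1)) ⊆ U i} with hV
  have hclosed : ∀ n i, IsClosed (V n i) := by
    intro n i
    have : V n i = (⋂ j : Iio i, (U j)ᶜ) ∩ ⋂ y : ↥(U i)ᶜ, {x | 1 / ((n : ℝ) + 1) ≤ dist (y : Ω) x} := by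
      ext x
      simp only [hV, mem_inter_iff, mem_ofPred_eq, mem_iInter, Subtype.forall, mem_Iio, mem_compl_iff]
      refine and_congr_right fun _ => ?_
      constructor
      · intro h y hy
        by_contra hlt
        exact hy (h (mem_ball.2 (not_le.1 hlt)))
      · intro h y hy
        by_contra hyU
        exact absurd (mem_ball.1 hy) (not_lt.2 (h y hyU))
    rw [this]
    refine IsClosed.inter (isClosed_iInter fun j => (hU j).isClosed_compl) ?_
    exact isClosed_iInter fun y => isClosed_le continuous_const (by fun_prop)
  have hsep : ∀ n i j x y, i < j → x ∈ V n i → y ∈ V n j → 1 / ((n : ℝ) + 1) ≤ dist x y := by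
    intro n i j x y hij hx hy
    by_contra hlt
    refine hy.1 i hij (hx.2 (mem_ball.2 ?_))
    rw [dist_comm]
    exact not_le.1 hlt
  have hcl : ∀ n, IsClosed (⋃ i ∈ J, V n i) := by
    intro n
    refine isClosed_of_closure_subset fun x hx => ?_
    rw [Metric.mem_closure_iff] at hx
    have hr : 0 < 1 / ((n : ℝ) + 1) / 2 := by positivity
    obtain ⟨y, hy, hxy⟩ := hx _ hr
    obtain ⟨i, hi, hyi⟩ := mem_iUnion₂.1 hy
    refine mem_iUnion₂.2 ⟨i, hi, ?_⟩
    rw [← (hclosed n i).closure_eq, Metric.mem_closure_iff]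
    intro ε hε
    obtain ⟨z, hz, hxz⟩ := hx _ (lt_min hε hr)
    obtain ⟨j, hj, hzj⟩ := mem_iUnion₂.1 hz
    have hyz : dist y z < 1 / ((n : ℝ) + 1) := by
      have := dist_triangle_left y z x
      have := lt_min_iff.1 hxz
      linarith
    have : j = i := by
      rcases lt_trichotomy i j with h | h | h
      · exact absurd (hsep n i j y z h hyi hzj) (not_le.2 hyz)
      · exact h.symm
      · exact absurd (hsep n j i z y h hzj hyi) (by rw [dist_comm]; exact not_le.2 hyz)
    subst this
    exact ⟨z, hzj, (lt_min_iff.1 hxz).1⟩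
  have : (⋃ i ∈ J, {x | x ∈ U i ∧ ∀ j < i, x ∉ U j}) = ⋃ n, ⋃ i ∈ J, V n i := by
    ext x
    simp only [mem_iUnion, mem_ofPred_eq, hV]
    constructor
    · rintro ⟨i, hi, hx, hx'⟩
      obtain ⟨ε, hε, hb⟩ := Metric.isOpen_iff.1 (hU i) x hx
      obtain ⟨n, hn⟩ := exists_nat_one_div_lt hε
      exact ⟨n, i, hi, hx', (ball_subset_ball hn.le).trans hb⟩
    · rintro ⟨n, i, hi, hx, hx'⟩
      exact ⟨i, hi, hx' (mem_ball_self (by positivity)), hx⟩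
  rw [this]
  exact MeasurableSet.iUnion fun n => (hcl n).measurableSet

theorem null_union {Ω : Type u} [MetricSpace Ω] [MeasurableSpace Ω] [BorelSpace Ω]
    (μ : Measure Ω) [IsFiniteMeasure μ] {I : Type u}
    (hI : ∀ τ : Cardinal.{u}, IsRealValuedMeasurableCardinal τ → #I < τ)
    (U : I → Set Ω) (hU : ∀ i, IsOpen (U i)) (h0 : ∀ i, μ (U i) = 0) : μ (⋃ i, U i) = 0 := by
  by_contra hne
  let _ : LinearOrder I := IsWellOrder.linearOrder WellOrderingRel
  have hwf : WellFounded ((· < ·) : I → I → Prop) := IsWellFounded.wf (r := WellOrderingRel)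
  have : Nonempty I := by
    by_contra hemp
    rw [not_nonempty_iff] at hemp
    exact hne (by simp)
  obtain ⟨i0⟩ := this
  set V : I → Set Ω := fun i => {x | x ∈ U i ∧ ∀ j < i, x ∉ U j} with hV
  have hp : ∀ x, ∃ i : I, (x ∈ (⋃ i, U i) ∧ x ∈ V i) ∨ (x ∉ (⋃ i, U i) ∧ i = i0) := by
    intro x
    by_cases hx : x ∈ ⋃ i, U i
    · obtain ⟨i, hi⟩ := mem_iUnion.1 hx
      obtain ⟨a, ha, hmin⟩ := hwf.has_min {i | x ∈ U i} ⟨i, hi⟩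
      exact ⟨a, Or.inl ⟨hx, ha, fun j hj hjx => hmin j hjx hj⟩⟩
    · exact ⟨i0, Or.inr ⟨hx, rfl⟩⟩
  choose p hp using hp
  have huniq : ∀ x i j, x ∈ V i → x ∈ V j → i = j := by
    intro x i j hi hj
    rcases lt_trichotomy i j with h | h | h
    · exact absurd hi.1 (hj.2 i h)
    · exact h
    · exact absurd hj.1 (hi.2 j h)
  let _ : MeasurableSpace I := ⊤
  have hUm : MeasurableSet (⋃ i, U i) := (isOpen_iUnion hU).measurableSet
  have hpm : Measurable p := by
    intro J _
    have : p ⁻¹' J = (⋃ i ∈ J, V i) ∪ ((⋃ i, U i)ᶜ ∩ {_x | i0 ∈ J}) := by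
      ext x
      simp only [mem_preimage, mem_union, mem_iUnion₂, mem_inter_iff, mem_compl_iff, mem_ofPred_eq]
      rcases hp x with ⟨h1, h2⟩ | ⟨h1, h2⟩
      · constructor
        · intro h
          exact Or.inl ⟨p x, h, h2⟩
        · rintro (⟨i, hi, hxi⟩ | ⟨h, -⟩)
          · rwa [huniq x _ _ h2 hxi]
          · exact absurd h1 h
      · constructor
        · intro h
          exact Or.inr ⟨h1, h2 ▸ h⟩
        · rintro (⟨i, hi, hxi⟩ | ⟨-, h⟩)
          · exact absurd (mem_iUnion.2 ⟨i, hxi.1⟩) h1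
          · rwa [h2]
    rw [this]
    exact (measurable_first U hU J).union (hUm.compl.inter (MeasurableSet.const _))
  obtain ⟨τ, hτ, hle⟩ := rvm_of_measure ((μ.restrict (⋃ i, U i)).map p) (by
      rw [Measure.map_apply hpm MeasurableSet.univ]
      simpa using hne) (by
      intro i
      rw [Measure.map_apply hpm trivial, Measure.restrict_apply (hpm trivial)]
      refine measure_mono_null ?_ (h0 i)
      rintro x ⟨hx, hxU⟩
      rcases hp x with ⟨h1, h2⟩ | ⟨h1, h2⟩
      · rw [show p x = i from hx] at h2
        exact h2.1
      · exact absurd hxU h1)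
  exact absurd (hI τ hτ) (not_lt.2 hle)

theorem exists_separable_support {Ω : Type u} [MetricSpace Ω] [MeasurableSpace Ω] [BorelSpace Ω]
    (hd : ∀ τ : Cardinal.{u}, IsRealValuedMeasurableCardinal τ → densityCard Ω < τ)
    (μ : Measure Ω) [IsProbabilityMeasure μ] :
    ∃ Y : Set Ω, IsClosed Y ∧ TopologicalSpace.IsSeparable Y ∧ μ Yᶜ = 0 := by
  obtain ⟨s, hs, hcard⟩ := density_attained Ω
  set U : s → Set Ω := fun z => ⋃ n : {n : ℕ // μ (ball (z : Ω) (1 / ((n : ℝ) + 1))) = 0},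
    ball (z : Ω) (1 / ((n : ℕ) + 1 : ℝ)) with hUdef
  have hU : ∀ i, IsOpen (U i) := fun i => isOpen_iUnion fun n => isOpen_ball
  have h0 : ∀ i, μ (U i) = 0 := fun i => measure_iUnion_null fun n => n.2
  have hnull := null_union μ (I := s) (by rw [hcard]; exact hd) U hU h0
  have hpos : ∀ x ∈ (⋃ i, U i)ᶜ, ∀ ε > 0, 0 < μ (ball x ε) := by
    intro x hx ε hε
    rw [pos_iff_ne_zero]
    intro hz
    apply hx
    obtain ⟨n, hn⟩ := exists_nat_one_div_lt (half_pos hε)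
    obtain ⟨z, hzs, hz'⟩ := hs.exists_dist_lt x (show 0 < 1 / ((n : ℝ) + 1) by positivity)
    refine mem_iUnion.2 ⟨⟨z, hzs⟩, mem_iUnion.2 ⟨⟨n, ?_⟩, mem_ball.2 hz'⟩⟩
    refine measure_mono_null (fun y hy => ?_) hz
    rw [mem_ball] at hy ⊢
    have := dist_triangle y z x
    rw [dist_comm z x] at this
    simp only at hy
    linarith
  refine ⟨(⋃ i, U i)ᶜ, (isOpen_iUnion hU).isClosed_compl, ?_, by rwa [compl_compl]⟩
  obtain ⟨A, hA, hcl⟩ := exists_sep (⋃ i, U i)ᶜ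
  refine ⟨⋃ n, A n, countable_iUnion fun n => ?_, hcl⟩
  have hr : 0 < 1 / ((n : ℝ) + 1) / 2 := by positivity
  have := Measure.countable_meas_pos_of_disjoint_iUnion (μ := μ)
    (As := fun x : A n => ball (x : Ω) (1 / ((n : ℝ) + 1) / 2)) (fun x => isOpen_ball.measurableSet) (by
      intro x y hxy
      refine ball_disjoint_ball ?_
      have := (hA n).2 x.2 y.2 (fun h => hxy (Subtype.ext h))
      linarith)
  have h2 : {i : A n | 0 < μ (ball (i : Ω) (1 / ((n : ℝ) + 1) / 2))} = Set.univ :=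
    eq_univ_of_forall fun x => hpos x ((hA n).1 x.2) _ hr
  rw [h2] at this
  exact countable_coe_iff.1 (countable_univ_iff.1 this)

structure AddM {K : Type u} [LinearOrder K] [MeasurableSpace K] (ν : Measure K) : Prop where
  single : ∀ x, ν {x} = 0
  union : ∀ (ι : Type u) (N : ι → Set K), #ι < #K → (∀ i, ν (N i) = 0) → ν (⋃ i, N i) = 0
  iio : ∀ a : K, #(Iio a) < #K

section
variable {K : Type u} [LinearOrder K] [MeasurableSpace K] [DiscreteMeasurableSpace K]
  {ν : Measure K} [IsProbabilityMeasure ν]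

theorem AddM.small (h : AddM ν) {s : Set K} (hs : #s < #K) : ν s = 0 := by
  have := h.union s (fun x => {(x : K)}) hs fun x => h.single x
  simpa using this

theorem AddM.card_of_pos (h : AddM ν) {s : Set K} (hs : ν s ≠ 0) : #K ≤ #s := by
  by_contra hc
  exact hs (h.small (not_le.1 hc))

theorem AddM.countable_null (h : AddM ν) {s : Set K} (hs : s.Countable) : ν s = 0 := by
  have := hs.to_subtype
  have := measure_iUnion_null (μ := ν) (s := fun x : s => {(x : K)}) fun x => h.single x
  simpa using this

theorem AddM.aleph0_lt (h : AddM ν) : ℵ₀ < #K := by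
  by_contra hc
  have : Countable K := Cardinal.mk_le_aleph0_iff.1 (not_lt.1 hc)
  have h1 := h.countable_null (countable_univ (α := K))
  simp at h1

theorem AddM.iic_null (h : AddM ν) (a : K) : ν (Iic a) = 0 := by
  rw [← Iio_union_right]
  exact measure_union_null (h.small (h.iio a)) (h.single a)

theorem AddM.bounded (h : AddM ν) {s : Set K} (hs : #s < #K) : ∃ a, ∀ x ∈ s, x < a := by
  have h1 := h.union s (fun x => Iic (x : K)) hs fun x => h.iic_null x
  by_contra hc
  push Not at hc
  have : (⋃ x : s, Iic (x : K)) = Set.univ := by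
    refine eq_univ_of_forall fun a => ?_
    obtain ⟨x, hx, hax⟩ := hc a
    exact mem_iUnion.2 ⟨⟨x, hx⟩, hax⟩
  rw [this] at h1
  simp at h1

theorem AddM.bounded_countable (h : AddM ν) {s : Set K} (hs : s.Countable) : ∃ a, ∀ x ∈ s, x < a :=
  h.bounded ((Cardinal.le_aleph0_iff_set_countable.2 hs).trans_lt h.aleph0_lt)

theorem AddM.values (h : AddM ν) {V : Type u} (g : K → V) (hg : #(range g) < #K) :
    {v | ν (g ⁻¹' {v}) ≠ 0}.Countable ∧ ν {x | ν (g ⁻¹' {g x}) = 0} = 0 := by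
  constructor
  · have := Measure.countable_meas_pos_of_disjoint_iUnion (μ := ν)
      (As := fun v : V => g ⁻¹' {v}) (fun x => MeasurableSet.of_discrete) (by
        intro x y hxy
        exact Disjoint.preimage _ (by simpa using hxy))
    simpa only [pos_iff_ne_zero] using this
  · refine measure_mono_null ?_ (h.union {v : range g // ν (g ⁻¹' {v.1}) = 0}
      (fun v => g ⁻¹' {v.1.1}) ((Cardinal.mk_subtype_le _).trans_lt hg) fun v => v.2)
    intro x hx
    exact mem_iUnion.2 ⟨⟨⟨g x, mem_range_self x⟩, hx⟩, rfl⟩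

theorem AddM.fubini (h : AddM ν) (R : ℕ → K → Set K) (hR : ∀ n, #(range (R n)) < #K) :
    ∫⁻ ξ, ν (⋃ n, R n ξ) ∂ν = ∫⁻ α, ν {ξ | ∃ n, α ∈ R n ξ} ∂ν := by
  set N : Set K := ⋃ n, {x | ν (R n ⁻¹' {R n x}) = 0} with hN
  have hN0 : ν N = 0 := measure_iUnion_null fun n => (h.values (R n) (hR n)).2
  set D : Set (K × K) := ⋃ n, ⋃ v ∈ {v | ν (R n ⁻¹' {v}) ≠ 0}, (R n ⁻¹' {v}) ×ˢ v with hD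
  have hDm : MeasurableSet D := by
    refine MeasurableSet.iUnion fun n => MeasurableSet.biUnion (h.values (R n) (hR n)).1 fun v _ => ?_
    exact MeasurableSet.of_discrete.prod MeasurableSet.of_discrete
  have hmem : ∀ ξ ∉ N, ∀ α, (ξ, α) ∈ D ↔ ∃ n, α ∈ R n ξ := by
    intro ξ hξ α
    simp only [hN, mem_iUnion, mem_ofPred_eq, not_exists] at hξ
    simp only [hD, mem_iUnion, mem_ofPred_eq, mem_prod, mem_preimage, mem_singleton_iff, exists_prop]
    constructor
    · rintro ⟨n, v, -, rfl, hα⟩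
      exact ⟨n, hα⟩
    · rintro ⟨n, hn⟩
      exact ⟨n, _, hξ n, rfl, hn⟩
  have hae : ∀ᵐ ξ ∂ν, ξ ∉ N := measure_eq_zero_iff_ae_notMem.1 hN0
  have e1 := Measure.prod_apply (μ := ν) (ν := ν) hDm
  have e2 := Measure.prod_apply_symm (μ := ν) (ν := ν) hDm
  calc ∫⁻ ξ, ν (⋃ n, R n ξ) ∂ν = ∫⁻ ξ, ν (Prod.mk ξ ⁻¹' D) ∂ν := by
        refine lintegral_congr_ae ?_
        filter_upwards [hae] with ξ hξ
        congr 1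
        ext α
        rw [mem_preimage, hmem ξ hξ α, mem_iUnion]
    _ = ∫⁻ α, ν ((fun ξ => (ξ, α)) ⁻¹' D) ∂ν := e1.symm.trans e2
    _ = _ := by
        refine lintegral_congr fun α => measure_congr ?_
        filter_upwards [hae] with ξ hξ
        exact propext (hmem ξ hξ α)

end

theorem exists_addM {τ : Cardinal.{u}} (hτ : IsRealValuedMeasurableCardinal τ) :
    ∃ (K : Type u) (_ : LinearOrder K) (_ : MeasurableSpace K) (_ : DiscreteMeasurableSpace K)
      (ν : Measure K) (_ : IsProbabilityMeasure ν), #K = τ ∧ AddM ν := by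
  obtain ⟨μ, h1, h2, h3⟩ := hτ
  obtain ⟨r, hr, hord⟩ := Cardinal.exists_ord_eq τ.out
  classical
  refine ⟨τ.out, IsWellOrder.linearOrder r, ⊤, @DiscreteMeasurableSpace.mk _ ⊤ fun _ => trivial, μ,
    @IsProbabilityMeasure.mk _ ⊤ _ h1, mk_out τ, ?_⟩
  refine @AddM.mk _ (IsWellOrder.linearOrder r) ⊤ _ h2 ?_ ?_
  · intro ι N hι hN
    have := h3 (range N) (mk_range_le.trans_lt (by rwa [mk_out] at hι)) (by
      rintro _ ⟨i, rfl⟩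
      exact hN i)
    rwa [sUnion_range] at this
  · intro a
    have := card_typein_lt a hord
    exact this

section
variable {K : Type u} [LinearOrder K] [MeasurableSpace K] [DiscreteMeasurableSpace K]
  {ν : Measure K} [IsProbabilityMeasure ν]

theorem AddM.exists_sep_inj (h : AddM ν) {Ω : Type u} [MetricSpace Ω] (hd : #K ≤ densityCard Ω) :
    ∃ (e : K → Ω) (ε : ℝ), 0 < ε ∧ ∀ a b, a ≠ b → ε ≤ dist (e a) (e b) := by
  obtain ⟨A, hA, hcl⟩ := exists_sep (Set.univ : Set Ω)
  have hdense : Dense (⋃ n, A n) := fun x => hcl (mem_univ x)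
  have hle : #K ≤ #(⋃ n, A n : Set Ω) :=
    hd.trans (csInf_le (OrderBot.bddBelow _) ⟨_, hdense, rfl⟩)
  obtain ⟨f⟩ := Cardinal.le_def _ _ |>.1 hle
  have : ∃ n, #K ≤ #(A n) := by
    by_contra hc
    push Not at hc
    have h1 : ∀ n, ν {a | (f a : Ω) ∈ A n} = 0 := by
      intro n
      refine h.small (lt_of_le_of_lt ?_ (hc n))
      refine mk_le_of_injective (f := fun a : {a | (f a : Ω) ∈ A n} => (⟨f a, a.2⟩ : A n)) ?_
      intro a b hab
      exact Subtype.ext (f.injective (Subtype.ext (congrArg (fun z : A n => (z : Ω)) hab)))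
    have h2 := measure_iUnion_null h1
    have h3 : (⋃ n, {a | (f a : Ω) ∈ A n}) = Set.univ := by
      refine eq_univ_of_forall fun a => ?_
      obtain ⟨n, hn⟩ := mem_iUnion.1 (f a).2
      exact mem_iUnion.2 ⟨n, hn⟩
    rw [h3] at h2
    simp at h2
  obtain ⟨n, hn⟩ := this
  obtain ⟨g⟩ := Cardinal.le_def _ _ |>.1 hn
  refine ⟨fun a => g a, 1 / ((n : ℝ) + 1), by positivity, fun a b hab => ?_⟩
  exact (hA n).2 (g a).2 (g b).2 fun hh => hab (g.injective (Subtype.ext hh))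

end

theorem sep_approx {Ω : Type u} [MetricSpace Ω] [MeasurableSpace Ω] [BorelSpace Ω]
    (hc : kNNUniversallyConsistent Ω) {L : Type*} [MeasurableSpace L] [DiscreteMeasurableSpace L]
    (ρ : Measure L) [IsProbabilityMeasure ρ] (e : L → Ω) {ε : ℝ} (hε : 0 < ε)
    (he : ∀ a b, a ≠ b → ε ≤ dist (e a) (e b)) (y : L → Bool) (δ : ℝ≥0∞) (hδ : 0 < δ) :
    ∃ (n k : ℕ) (π : Equiv.Perm (Fin n)) (σ : Fin n → L),
      ρ {x | kNNLabel n k (fun i => (e (σ i), y (σ i))) π (e x) ≠ y x} < δ := by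
  classical
  have hinj : ∀ a b, e a = e b → a = b := by
    intro a b hab
    by_contra hne
    have := he a b hne
    rw [hab, dist_self] at this
    linarith
  have hcl : IsClosed (e '' {x | y x = true}) := by
    refine Metric.isClosed_of_pairwise_le_dist hε ?_
    rintro _ ⟨a, -, rfl⟩ _ ⟨b, -, rfl⟩ hab
    exact he a b fun hh => hab (by rw [hh])
  refine consistent_approx hc ρ (fun a => (e a, y a)) Measurable.of_discrete
    (fun x => decide (x ∈ e '' {x | y x = true})) ?_ ?_ δ hδ
  · refine measurable_to_bool ?_
    convert hcl.measurableSet using 1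
    ext x
    simp
  · intro x
    rw [Bool.eq_iff_iff, decide_eq_true_eq]
    constructor
    · rintro ⟨z, hz, hzx⟩
      rw [← hinj _ _ hzx]
      exact hz
    · intro hx
      exact ⟨x, hx, rfl⟩

section
variable {K : Type u} [LinearOrder K] [MeasurableSpace K] [DiscreteMeasurableSpace K]
  {ν : Measure K} [IsProbabilityMeasure ν]

theorem AddM.equilateral (h : AddM ν) {Ω : Type u} [MetricSpace Ω] (e : K → Ω) (B : Set K)
    (hB : ν B ≠ 0) (hat : ∀ s : Set K, ν (B ∩ s) = 0 ∨ ν (B \ s) = 0) :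
    ∃ (S : Set K) (c : ℝ), #K ≤ #S ∧ ∀ a ∈ S, ∀ b ∈ S, a ≠ b → dist (e a) (e b) = c := by
  have hconst : ∀ φ : K → ℝ, ∃ c, ν {x | x ∈ B ∧ φ x ≠ c} = 0 := by
    intro φ
    obtain ⟨c, hc⟩ := Filter.exists_eventuallyEq_const_of_forall_separating
      (l := ae (ν.restrict B)) (f := φ) MeasurableSet (by
        intro U _
        rw [ae_restrict_iff' MeasurableSet.of_discrete, ae_restrict_iff' MeasurableSet.of_discrete,
          ae_iff, ae_iff]
        rcases hat (φ ⁻¹' U) with h1 | h1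
        · right
          convert h1 using 2
          ext x
          simp
        · left
          convert h1 using 2
          ext x
          simp)
    refine ⟨c, ?_⟩
    rw [Filter.EventuallyEq, ae_restrict_iff' MeasurableSet.of_discrete, ae_iff] at hc
    convert hc using 2
    ext x
    simp
  choose r hr using fun a => hconst fun x => dist (e a) (e x)
  obtain ⟨c, hc⟩ := hconst r
  obtain ⟨S, hS1, hS2, hS3⟩ := exists_max_pairwise (fun a b : K => dist (e a) (e b) = c)
    {a | a ∈ B ∧ r a = c}
  refine ⟨S, c, ?_, fun a ha b hb hab => hS2 ha hb hab⟩
  by_contra hlt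
  rw [not_le] at hlt
  have h1 := h.union S (fun a => {x | x ∈ B ∧ dist (e a) (e x) ≠ r a}) hlt fun a => hr a
  have h2 := measure_union_null (measure_union_null h1 (h.small hlt)) hc
  have : ∃ x ∈ B, x ∉ (((⋃ a : S, {x | x ∈ B ∧ dist (e a) (e x) ≠ r a}) ∪ S) ∪
      {x | x ∈ B ∧ r x ≠ c}) := by
    by_contra hcon
    push Not at hcon
    exact hB (measure_mono_null hcon h2)
  obtain ⟨x, hxB, hx⟩ := this
  simp only [mem_union, mem_iUnion, mem_ofPred_eq, not_or, not_exists, not_and, not_not] at hx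
  obtain ⟨⟨hx1, hx2⟩, hx3⟩ := hx
  obtain ⟨y, hy, hxy⟩ := hS3 x ⟨hxB, hx3 hxB⟩ hx2
  rw [dist_comm, or_self] at hxy
  exact hxy ((hx1 ⟨y, hy⟩ hxB).trans (hS1 hy).2)

instance discreteSum {X : Type*} [MeasurableSpace X] [DiscreteMeasurableSpace X] :
    DiscreteMeasurableSpace (X ⊕ X) :=
  ⟨fun _ => measurableSet_sum_iff.2 ⟨MeasurableSet.of_discrete, MeasurableSet.of_discrete⟩⟩

theorem AddM.atom_case (h : AddM ν) {Ω : Type u} [MetricSpace Ω] [MeasurableSpace Ω] [BorelSpace Ω]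
    (hcons : kNNUniversallyConsistent Ω) (e : K → Ω) {ε : ℝ} (hε : 0 < ε)
    (he : ∀ a b, a ≠ b → ε ≤ dist (e a) (e b)) (B : Set K)
    (hB : ν B ≠ 0) (hat : ∀ s : Set K, ν (B ∩ s) = 0 ∨ ν (B \ s) = 0) : False := by
  obtain ⟨S, c, hS, hSc⟩ := h.equilateral e B hB hat
  have hcard : #(K ⊕ K) ≤ #S := by
    rw [mk_sum, lift_id]
    rwa [Cardinal.add_eq_self h.aleph0_lt.le]
  obtain ⟨g⟩ := Cardinal.le_def _ _ |>.1 hcard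
  have hginj : ∀ a b, a ≠ b → (g a : K) ≠ g b := fun a b hab hh => hab (g.injective (Subtype.ext hh))
  set ρ : Measure (K ⊕ K) := (2⁻¹ : ℝ≥0∞) • (ν.map Sum.inl + ν.map Sum.inr) with hρ
  have hρa : ∀ s, ρ s = 2⁻¹ * (ν (Sum.inl ⁻¹' s) + ν (Sum.inr ⁻¹' s)) := by
    intro s
    rw [hρ, Measure.smul_apply, Measure.add_apply, Measure.map_apply measurable_inl MeasurableSet.of_discrete,
      Measure.map_apply measurable_inr MeasurableSet.of_discrete, smul_eq_mul]
  have hprob : IsProbabilityMeasure ρ := by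
    constructor
    rw [hρa]
    simp only [preimage_univ, measure_univ]
    rw [one_add_one_eq_two]
    exact ENNReal.inv_mul_cancel (by simp) (by simp)
  obtain ⟨n, k, π, σ, hlt⟩ := sep_approx hcons ρ (fun a => e (g a)) hε
    (fun a b hab => he _ _ (hginj a b hab)) Sum.isLeft 2⁻¹ (by simp)
  refine absurd hlt (not_lt.2 ?_)
  set c0 := kNNcore n k π (fun _ _ => False) (fun i => (σ i).isLeft) with hc0
  have hlab : ∀ x ∉ range σ, kNNLabel n k (fun i => (e (g (σ i)), (σ i).isLeft)) π (e (g x)) = c0 := by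
    intro x hx
    rw [kNNLabel_eq_core, hc0]
    congr 1
    funext j i
    have : ∀ i, dist (e (g x)) (e (g (σ i))) = c := fun i =>
      hSc _ (g x).2 _ (g (σ i)).2 (hginj _ _ fun hh => hx ⟨i, hh.symm⟩)
    simp [this]
  have hfin : ∀ (t : K → K ⊕ K), Function.Injective t → ν (t ⁻¹' (range σ)ᶜ) = 1 := by
    intro t ht
    rw [preimage_compl, prob_compl_eq_one_iff MeasurableSet.of_discrete]
    exact h.countable_null ((finite_range σ).preimage ht.injOn).countable
  rw [hρa]
  cases hcc : c0
  · calc (2⁻¹ : ℝ≥0∞) = 2⁻¹ * (ν (Sum.inl ⁻¹' (range σ)ᶜ)) := by rw [hfin _ Sum.inl_injective, mul_one]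
      _ ≤ _ := by
        gcongr
        refine le_add_right (measure_mono ?_)
        intro x hx
        simp [hlab _ hx, hcc]
  · calc (2⁻¹ : ℝ≥0∞) = 2⁻¹ * (ν (Sum.inr ⁻¹' (range σ)ᶜ)) := by rw [hfin _ Sum.inr_injective, mul_one]
      _ ≤ _ := by
        gcongr
        refine le_add_left (measure_mono ?_)
        intro x hx
        simp [hlab _ hx, hcc]

end

section
variable {K : Type u} [LinearOrder K] [MeasurableSpace K] [DiscreteMeasurableSpace K]
  {ν : Measure K} [IsProbabilityMeasure ν]

theorem halving (ν : Measure K) [IsProbabilityMeasure ν]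
    (hna : ∀ B : Set K, ν B ≠ 0 → ∃ s, ν (B ∩ s) ≠ 0 ∧ ν (B \ s) ≠ 0) (n : ℕ) :
    ∀ B : Set K, ν B ≠ 0 → ∃ A ⊆ B, ν A ≠ 0 ∧ ν A ≤ (2⁻¹ : ℝ≥0∞) ^ n := by
  induction n with
  | zero => exact fun B hB => ⟨B, Subset.rfl, hB, by simpa using prob_le_one⟩
  | succ n ih =>
    intro B hB
    obtain ⟨A, hAB, hA, hAn⟩ := ih B hB
    obtain ⟨s, hs1, hs2⟩ := hna A hA
    have hsum : ν (A ∩ s) + ν (A \ s) = ν A := measure_inter_add_diff A MeasurableSet.of_discrete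
    have key : ∀ a b : ℝ≥0∞, a + b = ν A → a ≤ b → a ≤ (2⁻¹ : ℝ≥0∞) ^ (n + 1) := by
      intro a b hab hle
      rw [pow_succ, ← div_eq_mul_inv, ENNReal.le_div_iff_mul_le (by simp) (by simp), mul_two]
      calc a + a ≤ a + b := by gcongr
        _ ≤ _ := hab.le.trans hAn
    rcases le_total (ν (A ∩ s)) (ν (A \ s)) with hle | hle
    · exact ⟨A ∩ s, inter_subset_left.trans hAB, hs1, key _ _ hsum hle⟩
    · exact ⟨A \ s, diff_subset.trans hAB, hs2, key _ _ (by rw [add_comm]; exact hsum) hle⟩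

theorem AddM.exists_inj (h : AddM ν)
    (hna : ∀ B : Set K, ν B ≠ 0 → ∃ s, ν (B ∩ s) ≠ 0 ∧ ν (B \ s) ≠ 0) :
    ∃ f : K → ℕ → Prop, Function.Injective f := by
  have hfam : ∀ n : ℕ, ∃ F : Set (Set K), F.Countable ∧ (∀ A ∈ F, ν A ≤ (2⁻¹ : ℝ≥0∞) ^ n) ∧
      ν (⋃₀ F)ᶜ = 0 := by
    intro n
    obtain ⟨F, h1, h2, h3⟩ := exists_max_pairwise (fun A B : Set K => Disjoint A B)
      {A | ν A ≠ 0 ∧ ν A ≤ (2⁻¹ : ℝ≥0∞) ^ n}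
    refine ⟨F, ?_, fun A hA => (h1 hA).2, ?_⟩
    · have := Measure.countable_meas_pos_of_disjoint_iUnion (μ := ν)
        (As := fun A : F => (A : Set K)) (fun x => MeasurableSet.of_discrete) (by
          intro A B hAB
          exact h2 A.2 B.2 fun hh => hAB (Subtype.ext hh))
      have hu : {i : F | 0 < ν (i : Set K)} = Set.univ :=
        eq_univ_of_forall fun A => pos_iff_ne_zero.2 (h1 A.2).1
      rw [hu] at this
      exact countable_coe_iff.1 (countable_univ_iff.1 this)
    · by_contra hne
      obtain ⟨A, hA, hA1, hA2⟩ := halving ν hna n _ hne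
      have hd : ∀ B ∈ F, Disjoint A B := fun B hB =>
        Set.disjoint_left.2 fun x hx hxB => hA hx ⟨B, hB, hxB⟩
      obtain ⟨B, hB, hAB⟩ := h3 A ⟨hA1, hA2⟩ (by
        intro hAF
        have := hd A hAF
        rw [disjoint_self] at this
        exact hA1 (by rw [this]; simp))
      rw [disjoint_comm (a := B), or_self] at hAB
      exact hAB (hd B hB)
  choose F hF1 hF2 hF3 using hfam
  have henc : ∀ n, ∃ en : Set K → ℕ, InjOn en (F n) := fun n => (Set.countable_iff_exists_injOn).1 (hF1 n)
  choose en hen using henc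
  set φ : K → ULift.{u} (ℕ → Set ℕ) := fun x => ⟨fun n => {m | ∃ A ∈ F n, x ∈ A ∧ en n A = m}⟩ with hφ
  have hfib : ∀ x, ν (φ ⁻¹' {φ x}) = 0 := by
    intro x
    by_cases hx : ∃ n, x ∉ ⋃₀ F n
    · obtain ⟨n, hn⟩ := hx
      refine measure_mono_null ?_ (hF3 n)
      rintro z hz ⟨A, hA, hzA⟩
      have hz' : (φ z).down n = (φ x).down n := by rw [show φ z = φ x from hz]
      have : en n A ∈ (φ z).down n := ⟨A, hA, hzA, rfl⟩
      rw [hz'] at this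
      obtain ⟨B, hB, hxB, -⟩ := this
      exact hn ⟨B, hB, hxB⟩
    · push Not at hx
      refine le_antisymm ?_ bot_le
      refine ge_of_tendsto' (ENNReal.tendsto_pow_atTop_nhds_zero_of_lt_one (r := 2⁻¹) (by simp)) fun n => ?_
      obtain ⟨A, hA, hxA⟩ := hx n
      refine (measure_mono ?_).trans (hF2 n A hA)
      intro z hz
      have hz' : (φ z).down n = (φ x).down n := by rw [show φ z = φ x from hz]
      have : en n A ∈ (φ x).down n := ⟨A, hA, hxA, rfl⟩
      rw [← hz'] at this
      obtain ⟨B, hB, hzB, hBA⟩ := this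
      rwa [← hen n hB hA hBA]
  have hcard : #K ≤ #(range φ) := by
    by_contra hlt
    have := (h.values φ (not_le.1 hlt)).2
    simp [hfib] at this
  obtain ⟨g⟩ := Cardinal.le_def _ _ |>.1 (hcard.trans (mk_set_le (range φ)))
  refine ⟨fun x m => (Nat.unpair m).2 ∈ (g x).down (Nat.unpair m).1, fun x y hxy => ?_⟩
  apply g.injective
  apply ULift.ext
  funext n
  ext m
  have := congrFun hxy (Nat.pair n m)
  simpa using this

end

/-- sets determined by finitely many of the `b a`, `a < δ` -/
def RA {K : Type u} [LinearOrder K] (b : K → Set K) (δ : K) : Set (Set K) :=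
  {R | ∃ F : Finset K, (∀ a ∈ F, a < δ) ∧ ∀ x y, (∀ a ∈ F, (x ∈ b a ↔ y ∈ b a)) → (x ∈ R → y ∈ R)}

def Sm {K : Type u} [LinearOrder K] [MeasurableSpace K] (ν : Measure K) (b : K → Set K) (δ : K)
    (X : Set K) : Prop :=
  ∀ ε : ℝ≥0∞, ε ≠ 0 → ∃ 𝒞 : Set (Set K), 𝒞.Countable ∧ 𝒞 ⊆ RA b δ ∧ X ⊆ ⋃₀ 𝒞 ∧ ν (⋃₀ 𝒞) ≤ ε

section
variable {K : Type u} [LinearOrder K] [MeasurableSpace K] [DiscreteMeasurableSpace K]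
  {ν : Measure K} [IsProbabilityMeasure ν]

theorem AddM.exists_family (h : AddM ν) :
    ∃ G : Set (K → K), #K < #G ∧ G.Pairwise fun g g' => ν {α | g α = g' α} = 0 := by
  obtain ⟨G, -, h2, h3⟩ := exists_max_pairwise (fun g g' : K → K => ν {α | g α = g' α} = 0) Set.univ
  refine ⟨G, ?_, h2⟩
  by_contra hle
  obtain ⟨ψ⟩ := Cardinal.le_def _ _ |>.1 (not_lt.1 hle)
  have hex : ∀ α : K, ∃ z : K, ∀ γ : G, ψ γ < α → (γ : K → K) α ≠ z := by
    intro α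
    by_contra hcon
    push Not at hcon
    choose γ hγ1 hγ2 using hcon
    have : #K ≤ #(Iio α) := mk_le_of_injective (f := fun z => (⟨ψ (γ z), hγ1 z⟩ : Iio α)) (by
      intro z z' hzz
      have : γ z = γ z' := ψ.injective (congrArg Subtype.val hzz)
      rw [← hγ2 z, ← hγ2 z', this])
    exact absurd (h.iio α) (not_lt.2 this)
  choose g hg using hex
  have hag : ∀ γ ∈ G, ν {α | γ α = g α} = 0 := by
    intro γ hγ
    refine measure_mono_null ?_ (h.iic_null (ψ ⟨γ, hγ⟩))
    intro α hα
    by_contra hlt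
    exact hg α ⟨γ, hγ⟩ (not_le.1 hlt) hα
  have hgG : g ∉ G := by
    intro hgG
    have := hag g hgG
    simp at this
  obtain ⟨γ, hγ, hc⟩ := h3 g (mem_univ _) hgG
  have h4 : ν {α | g α = γ α} = 0 := by
    rw [← hag γ hγ]
    congr 1
    ext α
    exact eq_comm
  rcases hc with hc | hc
  · exact hc h4
  · exact hc (hag γ hγ)

theorem RA_empty (b : K → Set K) (δ : K) : ∅ ∈ RA b δ := ⟨∅, by simp, by simp⟩

theorem RA_sInter (b : K → Set K) (δ : K) {t : Set (Set K)} (ht : t.Finite) (h : t ⊆ RA b δ) :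
    ⋂₀ t ∈ RA b δ := by
  classical
  induction t, ht using Set.Finite.induction_on with
  | empty => exact ⟨∅, by simp, by simp⟩
  | @insert R s _ _ ih =>
    obtain ⟨F, hF1, hF2⟩ := h (mem_insert _ _)
    obtain ⟨F', hF1', hF2'⟩ := ih ((subset_insert _ _).trans h)
    refine ⟨F ∪ F', ?_, ?_⟩
    · intro a ha
      rcases Finset.mem_union.1 ha with ha | ha
      · exact hF1 a ha
      · exact hF1' a ha
    · intro x y hxy hx
      rw [sInter_insert] at hx ⊢
      exact ⟨hF2 x y (fun a ha => hxy a (Finset.mem_union_left _ ha)) hx.1,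
        hF2' x y (fun a ha => hxy a (Finset.mem_union_right _ ha)) hx.2⟩

theorem mk_finset_le' (X : Type u) : #(Finset X) ≤ max ℵ₀ #X := by
  rcases finite_or_infinite X with hX | hX
  · exact (Cardinal.mk_le_aleph0 (α := Finset X)).trans (le_max_left _ _)
  · rw [Cardinal.mk_finset_of_infinite]
    exact le_max_right _ _

theorem AddM.card_RA (h : AddM ν) (b : K → Set K) (δ : K) : #(RA b δ) < #K := by
  classical
  have hs : RA b δ ⊆ range (fun p : Finset (Iio δ) × Finset (Finset (Iio δ)) =>
      {x : K | (p.1.filter fun a : Iio δ => x ∈ b (a : K)) ∈ p.2}) := by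
    rintro R ⟨F, hF1, hF2⟩
    set F' : Finset (Iio δ) := F.attach.image fun a => ⟨a.1, hF1 a.1 a.2⟩ with hF'
    have hmem : ∀ a (ha : a ∈ F), (⟨a, hF1 a ha⟩ : Iio δ) ∈ F' := by
      intro a ha
      exact Finset.mem_image.2 ⟨⟨a, ha⟩, Finset.mem_attach _ _, rfl⟩
    refine ⟨(F', F'.powerset.filter fun T => ∃ y ∈ R, (F'.filter fun a : Iio δ => y ∈ b (a : K)) = T), ?_⟩
    ext x
    simp only [mem_ofPred_eq, Finset.mem_filter, Finset.mem_powerset, Finset.filter_subset, true_and]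
    constructor
    · rintro ⟨y, hy, hyx⟩
      refine hF2 y x (fun a ha => ?_) hy
      have := congrArg (fun T => (⟨a, hF1 a ha⟩ : Iio δ) ∈ T) hyx
      simpa [hmem a ha] using this
    · intro hx
      exact ⟨x, hx, rfl⟩
  refine (mk_le_mk_of_subset hs).trans_lt (mk_range_le.trans_lt ?_)
  have h1 : #(Finset (Iio δ)) < #K := (mk_finset_le' _).trans_lt (max_lt h.aleph0_lt (h.iio δ))
  have h2 : #(Finset (Finset (Iio δ))) < #K := (mk_finset_le' _).trans_lt (max_lt h.aleph0_lt h1)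
  rw [mk_prod, lift_id, lift_id]
  exact mul_lt_of_lt h.aleph0_lt.le h1 h2

theorem Sm_iUnion (b : K → Set K) (δ : K) (Y : ℕ → Set K) (hY : ∀ q, Sm ν b δ (Y q)) :
    Sm ν b δ (⋃ q, Y q) := by
  intro ε hε
  obtain ⟨ε', hε', hsum⟩ := ENNReal.exists_pos_sum_of_countable' hε ℕ
  choose 𝒞 h1 h2 h3 h4 using fun q => hY q (ε' q) (hε' q).ne'
  refine ⟨⋃ q, 𝒞 q, countable_iUnion h1, iUnion_subset h2, ?_, ?_⟩
  · rw [sUnion_iUnion]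
    exact iUnion_mono h3
  · rw [sUnion_iUnion]
    exact (measure_iUnion_le _).trans ((ENNReal.tsum_le_tsum h4).trans hsum.le)

theorem AddM.kunen (h : AddM ν) (b : K → Set K) (δ : K) (X : Set K) (hX : ν X ≠ 0) :
    ∃ ξ, ¬ Sm ν b δ (X ∩ Iio ξ) := by
  by_contra hcon
  push Not at hcon
  have hX2 : ν X / 2 ≠ 0 := by simp [hX]
  choose 𝒞 h1 h2 h3 h4 using fun ξ => hcon ξ (ν X / 2) hX2
  have hen : ∀ ξ, ∃ R : ℕ → Set K, insert ∅ (𝒞 ξ) = range R := fun ξ =>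
    ((h1 ξ).insert ∅).exists_eq_range (insert_nonempty _ _)
  choose R hR using hen
  have hU : ∀ ξ, ⋃ n, R ξ n = ⋃₀ 𝒞 ξ := by
    intro ξ
    rw [← sUnion_range, ← hR, sUnion_insert, empty_union]
  have hRA : ∀ ξ n, R ξ n ∈ RA b δ := by
    intro ξ n
    have : R ξ n ∈ insert ∅ (𝒞 ξ) := by rw [hR]; exact mem_range_self n
    rcases this with hh | hh
    · rw [hh]; exact RA_empty b δ
    · exact h2 ξ hh
  have hF := h.fubini (fun n ξ => R ξ n) fun n =>
    (mk_le_mk_of_subset (range_subset_iff.2 fun ξ => hRA ξ n)).trans_lt (h.card_RA b δ)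
  have hl : ∫⁻ ξ, ν (⋃ n, R ξ n) ∂ν ≤ ν X / 2 := by
    calc ∫⁻ ξ, ν (⋃ n, R ξ n) ∂ν ≤ ∫⁻ _, ν X / 2 ∂ν := lintegral_mono fun ξ => by
          rw [hU]; exact h4 ξ
      _ = _ := by simp
  have hr : ν X ≤ ∫⁻ α, ν {ξ | ∃ n, α ∈ R ξ n} ∂ν := by
    calc ν X = ∫⁻ α, X.indicator 1 α ∂ν := by
          rw [lintegral_indicator_one MeasurableSet.of_discrete]
      _ ≤ _ := by
        refine lintegral_mono fun α => ?_
        by_cases hα : α ∈ X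
        · rw [indicator_of_mem hα, Pi.one_apply]
          have : ν (Iic α)ᶜ = 1 := (prob_compl_eq_one_iff MeasurableSet.of_discrete).2 (h.iic_null α)
          rw [← this]
          refine measure_mono fun ξ hξ => ?_
          have hm : α ∈ ⋃ n, R ξ n := by
            rw [hU]
            exact h3 ξ ⟨hα, not_le.1 hξ⟩
          exact mem_iUnion.1 hm
        · simp [hα]
  have := hr.trans (hF.symm.le.trans hl)
  exact absurd this (not_le.2 (ENNReal.half_lt_self hX (measure_ne_top _ _)))

end

section
variable {K : Type u} [LinearOrder K] [MeasurableSpace K] [DiscreteMeasurableSpace K]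
  {ν : Measure K} [IsProbabilityMeasure ν]

theorem AddM.markov_small (h : AddM ν) (b : K → Set K) (δ : K) (R : K → Set K)
    (hR : ∀ γ, R γ ∈ RA b δ) (c ε : ℝ≥0∞) (hc : c ≠ 0) (hc' : c ≠ ⊤)
    (hε : ∀ γ, ν (R γ) ≤ c * ε) :
    ∃ 𝒞 : Set (Set K), 𝒞.Countable ∧ 𝒞 ⊆ RA b δ ∧ {α | c < ν {γ | α ∈ R γ}} ⊆ ⋃₀ 𝒞 ∧
      ν (⋃₀ 𝒞) ≤ ε := by
  have hcard : #(range R) < #K :=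
    (mk_le_mk_of_subset (range_subset_iff.2 hR)).trans_lt (h.card_RA b δ)
  set V : Set (Set K) := {v | ν (R ⁻¹' {v}) ≠ 0} with hV
  obtain ⟨hVc, hVn⟩ := h.values R hcard
  have hVR : V ⊆ RA b δ := by
    intro v hv
    obtain ⟨γ, hγ⟩ := nonempty_of_measure_ne_zero hv
    rw [← show R γ = v from hγ]
    exact hR γ
  refine ⟨(fun t => ⋂₀ t) '' {t | (t.Finite ∧ t ⊆ V) ∧ c < ν (R ⁻¹' t)}, ?_, ?_, ?_, ?_⟩
  · exact ((countable_ofPred_finite_subset hVc).mono fun t ht => ht.1).image _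
  · rintro _ ⟨t, ht, rfl⟩
    exact RA_sInter b δ ht.1.1 (ht.1.2.trans hVR)
  · intro α hα
    set W : Set (Set K) := {v | v ∈ V ∧ α ∈ v} with hW
    have hWc : W.Countable := hVc.mono fun v hv => hv.1
    have hWc' := hWc.to_subtype
    have h1 : ν {γ | α ∈ R γ} ≤ ν (⋃ s : Finset W, R ⁻¹' (Subtype.val '' (s : Set W))) := by
      rw [← zero_add (ν (⋃ s : Finset W, _)), ← hVn]
      refine (measure_mono ?_).trans (measure_union_le _ _)
      intro γ hγ
      by_cases hz : ν (R ⁻¹' {R γ}) = 0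
      · exact Or.inl hz
      · right
        refine mem_iUnion.2 ⟨{⟨R γ, hz, hγ⟩}, ?_⟩
        simp
    rw [Directed.measure_iUnion] at h1
    · obtain ⟨s, hs⟩ := lt_iSup_iff.1 (lt_of_lt_of_le hα h1)
      refine ⟨_, ⟨_, ⟨⟨s.finite_toSet.image Subtype.val, ?_⟩, hs⟩, rfl⟩, ?_⟩
      · rintro _ ⟨v, -, rfl⟩
        exact v.2.1
      · rintro _ ⟨v, -, rfl⟩
        exact v.2.2
    · refine Monotone.directed_le fun s t hst => ?_
      exact preimage_mono (image_mono (Finset.coe_subset.2 hst))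
  · have hF := h.fubini (fun _ => R) fun _ => hcard
    simp only [iUnion_const, exists_const] at hF
    have hle : ∫⁻ α, ν {ξ | α ∈ R ξ} ∂ν ≤ c * ε := by
      rw [← hF]
      calc ∫⁻ ξ, ν (R ξ) ∂ν ≤ ∫⁻ _, c * ε ∂ν := lintegral_mono hε
        _ = _ := by simp
    have hM := mul_meas_ge_le_lintegral (μ := ν) (f := fun α => ν {ξ | α ∈ R ξ})
      Measurable.of_discrete c
    have hsub : ν (⋃₀ ((fun t => ⋂₀ t) '' {t | (t.Finite ∧ t ⊆ V) ∧ c < ν (R ⁻¹' t)})) ≤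
        ν {α | c ≤ ν {ξ | α ∈ R ξ}} := by
      refine measure_mono ?_
      rintro α ⟨_, ⟨t, ht, rfl⟩, hα⟩
      refine ht.2.le.trans (measure_mono fun γ hγ => ?_)
      exact hα _ hγ
    refine hsub.trans ?_
    exact (ENNReal.mul_le_mul_iff_right hc hc').1 (hM.trans hle)

theorem AddM.final (h : AddM ν) (b : K → Set K) (δ ξ β : K) (g : K → K → K) (X : K → Set K)
    (h1 : ∀ γ, ¬ Sm ν b δ (X γ ∩ Iio ξ)) (h2 : ∀ γ, ∀ α < ξ, g γ α < β)
    (h3 : ∀ γ γ', γ ≠ γ' → ∀ ε : ℝ≥0∞, ε ≠ 0 → ∃ R ∈ RA b δ,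
      (∀ α, α ∈ X γ → α ∈ X γ' → g γ α = g γ' α → α ∈ R) ∧ ν R ≤ ε) : False := by
  classical
  set Φ : K → K → Option K := fun α γ => if α ∈ X γ then some (g γ α) else none with hΦ
  have hΦr : ∀ α < ξ, #(range (Φ α)) < #K := by
    intro α hα
    have hsub : range (Φ α) ⊆ insert none (some '' Iio β) := by
      rintro _ ⟨γ, rfl⟩
      by_cases hγ : α ∈ X γ
      · right
        exact ⟨g γ α, h2 γ α hα, by simp [hΦ, hγ]⟩
      · left
        simp [hΦ, hγ]
    refine (mk_le_mk_of_subset hsub).trans_lt (mk_insert_le.trans_lt ?_)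
    exact add_lt_of_lt h.aleph0_lt.le (mk_image_le.trans_lt (h.iio β))
      (one_lt_aleph0.trans h.aleph0_lt)
  have hnull := h.union (Iio ξ) (fun α => {γ | ν (Φ α ⁻¹' {Φ α γ}) = 0}) (h.iio ξ)
    fun α => (h.values (Φ α) (hΦr α α.2)).2
  have : ∃ γ0, γ0 ∉ ⋃ α : Iio ξ, {γ | ν (Φ α ⁻¹' {Φ α γ}) = 0} := by
    by_contra hcon
    push Not at hcon
    rw [eq_univ_of_forall hcon] at hnull
    simp at hnull
  obtain ⟨γ0, hγ0⟩ := this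
  simp only [mem_iUnion, mem_ofPred_eq, not_exists] at hγ0
  apply h1 γ0
  set w : K → ℝ≥0∞ := fun α => ν {γ' | α ∈ X γ' ∧ g γ0 α = g γ' α} with hw
  have hwpos : ∀ α ∈ X γ0 ∩ Iio ξ, w α ≠ 0 := by
    intro α hα hz
    refine hγ0 ⟨α, hα.2⟩ (measure_mono_null ?_ hz)
    intro γ' hγ'
    have e : Φ α γ' = Φ α γ0 := hγ'
    simp only [hΦ, if_pos hα.1] at e
    split_ifs at e with hX
    exact ⟨hX, (Option.some.inj e).symm⟩
  have hcov : X γ0 ∩ Iio ξ = ⋃ q : ℕ, {α | α ∈ X γ0 ∩ Iio ξ ∧ ((q : ℝ≥0∞) + 1)⁻¹ < w α} := by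
    ext α
    simp only [mem_iUnion, mem_ofPred_eq, exists_and_left]
    refine ⟨fun hα => ⟨hα, ?_⟩, fun hα => hα.1⟩
    obtain ⟨q, hq⟩ := ENNReal.exists_inv_nat_lt (hwpos α hα)
    refine ⟨q, lt_of_le_of_lt ?_ hq⟩
    exact ENNReal.inv_le_inv.2 le_self_add
  rw [hcov]
  refine Sm_iUnion b δ _ fun q => ?_
  intro ε hε
  set c : ℝ≥0∞ := ((q : ℝ≥0∞) + 1)⁻¹ with hc
  have hc0 : c ≠ 0 := ENNReal.inv_ne_zero.2 (by simp)
  have hct : c ≠ ⊤ := ENNReal.inv_ne_top.2 (by simp)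
  have hex : ∀ γ', ∃ R ∈ RA b δ, (γ0 ≠ γ' → ∀ α, α ∈ X γ0 → α ∈ X γ' → g γ0 α = g γ' α → α ∈ R) ∧
      ν R ≤ c * ε := by
    intro γ'
    by_cases hne : γ0 = γ'
    · exact ⟨∅, RA_empty b δ, fun hh => absurd hne hh, by simp⟩
    · obtain ⟨R, hR1, hR2, hR3⟩ := h3 γ0 γ' hne (c * ε) (mul_ne_zero hc0 hε)
      exact ⟨R, hR1, fun _ => hR2, hR3⟩
  choose R hR1 hR2 hR3 using hex
  obtain ⟨𝒞, c1, c2, c3, c4⟩ := h.markov_small b δ R hR1 c ε hc0 hct hR3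
  refine ⟨𝒞, c1, c2, fun α hα => c3 ?_, c4⟩
  refine lt_of_lt_of_le hα.2 ?_
  calc w α ≤ ν ({γ' | α ∈ R γ'} ∪ {γ0}) := by
        refine measure_mono ?_
        rintro γ' ⟨hX, hg⟩
        by_cases hne : γ0 = γ'
        · exact Or.inr hne.symm
        · exact Or.inl (hR2 γ' hne α hα.1.1 hX hg)
    _ ≤ ν {γ' | α ∈ R γ'} + ν {γ0} := measure_union_le _ _
    _ = _ := by rw [h.single, add_zero]

theorem AddM.gs (h : AddM ν) (f : K → ℕ → Prop) (hf : Function.Injective f) (b : K → Set K)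
    (hb : ∀ C : Set K, ∀ ε : ℝ≥0∞, 0 < ε → ∃ a, ν {x | ¬ (x ∈ C ↔ x ∈ b a)} < ε) : False := by
  classical
  obtain ⟨G, hG1, hG2⟩ := h.exists_family
  obtain ⟨ε, hε, hsum⟩ := ENNReal.exists_pos_sum_of_countable' (ε := 1) one_ne_zero (ℕ × ℕ)
  choose a ha using fun (γ : G) (M m : ℕ) => hb {x | f ((γ : K → K) x) m} (ε (M, m)) (hε _)
  set X : G → Set K := fun γ => {α | ∀ M m, (f ((γ : K → K) α) m ↔ α ∈ b (a γ M m))} with hX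
  have hXpos : ∀ γ, ν (X γ) ≠ 0 := by
    intro γ hz
    have h1 : ν (X γ)ᶜ = 1 := (prob_compl_eq_one_iff MeasurableSet.of_discrete).2 hz
    have h2 : ν (X γ)ᶜ ≤ ∑' p : ℕ × ℕ, ε p := by
      refine (measure_mono ?_).trans ((measure_iUnion_le (fun p : ℕ × ℕ =>
        {x | ¬ (f ((γ : K → K) x) p.2 ↔ x ∈ b (a γ p.1 p.2))})).trans
          (ENNReal.tsum_le_tsum fun p => (ha γ p.1 p.2).le))
      intro α hα
      simp only [hX, mem_compl_iff, mem_ofPred_eq, not_forall] at hα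
      obtain ⟨M, m, hm⟩ := hα
      exact mem_iUnion.2 ⟨(M, m), hm⟩
    rw [h1] at h2
    exact absurd h2 (not_le.2 hsum)
  have hδ : ∀ γ : G, ∃ δ, ∀ M m, a γ M m < δ := by
    intro γ
    obtain ⟨δ, hδ⟩ := h.bounded_countable (countable_range fun p : ℕ × ℕ => a γ p.1 p.2)
    exact ⟨δ, fun M m => hδ _ ⟨(M, m), rfl⟩⟩
  choose δ hδ using hδ
  choose ξ hξ using fun γ => h.kunen b (δ γ) (X γ) (hXpos γ)
  have hβ : ∀ γ : G, ∃ β, ∀ α < ξ γ, (γ : K → K) α < β := by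
    intro γ
    obtain ⟨β, hβ⟩ := h.bounded (s := (γ : K → K) '' Iio (ξ γ)) (mk_image_le.trans_lt (h.iio _))
    exact ⟨β, fun α hα => hβ _ ⟨α, hα, rfl⟩⟩
  choose β hβ using hβ
  have hKKK : #(K × K × K) = #K := by
    simp only [mk_prod, lift_id, Cardinal.mul_eq_self h.aleph0_lt.le]
  obtain ⟨⟨δ0, ξ0, β0⟩, hp⟩ := Cardinal.infinite_pigeonhole_card_lt
    (fun γ : G => (δ γ, ξ γ, β γ)) (by rw [hKKK]; exact hG1) (h.aleph0_lt.le.trans hG1.le)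
  rw [hKKK] at hp
  obtain ⟨i⟩ := Cardinal.le_def _ _ |>.1 hp.le
  have hi : ∀ x, δ (i x).1 = δ0 ∧ ξ (i x).1 = ξ0 ∧ β (i x).1 = β0 := by
    intro x
    have e : (δ (i x).1, ξ (i x).1, β (i x).1) = (δ0, ξ0, β0) := (i x).2
    simpa using e
  refine h.final b δ0 ξ0 β0 (fun x => ((i x).1 : K → K)) (fun x => X (i x).1) ?_ ?_ ?_
  · intro x
    have := hξ (i x).1
    rwa [(hi x).1, (hi x).2.1] at this
  · intro x α hα
    have := hβ (i x).1 α (by rwa [(hi x).2.1])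
    rwa [(hi x).2.2] at this
  · intro x x' hxx η hη
    set γ := (i x).1 with hγ
    set γ' := (i x').1 with hγ'
    have hne : (γ : K → K) ≠ γ' := fun hh => hxx (i.injective (Subtype.ext (Subtype.ext hh)))
    have hag : ν {α | (γ : K → K) α = (γ' : K → K) α} = 0 := hG2 γ.2 γ'.2 hne
    set s : ℕ → ℝ≥0∞ := fun M => ∑' m, ε (M, m) with hs
    have hs0 : Tendsto s atTop (nhds 0) := by
      refine ENNReal.tendsto_atTop_zero_of_tsum_ne_top ?_
      rw [hs, ← ENNReal.tsum_prod (f := fun M m => ε (M, m))]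
      exact (hsum.trans ENNReal.one_lt_top).ne
    set D : ℕ → Set K := fun M => {α | ∀ m ≤ M, (f ((γ : K → K) α) m ↔ f ((γ' : K → K) α) m)} with hD
    have hD0 : Tendsto (fun M => ν (D M)) atTop (nhds 0) := by
      have := tendsto_measure_iInter_atTop (μ := ν) (s := D)
        (fun M => MeasurableSet.of_discrete.nullMeasurableSet) (by
          intro M M' hMM α hα m hm
          exact hα m (hm.trans hMM)) ⟨0, measure_ne_top _ _⟩
      have hz : ν (⋂ M, D M) = 0 := by
        refine measure_mono_null ?_ hag
        intro α hα
        apply hf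
        funext m
        exact propext (mem_iInter.1 hα m m le_rfl)
      rwa [hz] at this
    have hlim : Tendsto (fun M => ν (D M) + (s M + s M)) atTop (nhds 0) := by
      simpa using hD0.add (hs0.add hs0)
    obtain ⟨M, hM⟩ := (hlim.eventually (gt_mem_nhds (pos_iff_ne_zero.2 hη))).exists
    have herr : ∀ γ : G, ν (⋃ m, {x | ¬ (f ((γ : K → K) x) m ↔ x ∈ b (a γ M m))}) ≤ s M := fun γ =>
      (measure_iUnion_le _).trans (ENNReal.tsum_le_tsum fun m => (ha γ M m).le)
    refine ⟨{α | ∀ m ≤ M, (α ∈ b (a γ M m) ↔ α ∈ b (a γ' M m))}, ?_, ?_, ?_⟩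
    · refine ⟨(Finset.range (M + 1)).image (a γ M) ∪ (Finset.range (M + 1)).image (a γ' M), ?_, ?_⟩
      · intro z hz
        rcases Finset.mem_union.1 hz with hz | hz
        · obtain ⟨m, -, rfl⟩ := Finset.mem_image.1 hz
          rw [← (hi x).1]
          exact hδ _ _ _
        · obtain ⟨m, -, rfl⟩ := Finset.mem_image.1 hz
          rw [← (hi x').1]
          exact hδ _ _ _
      · intro y z hyz hy m hm
        have hm' : m ∈ Finset.range (M + 1) := Finset.mem_range.2 (by omega)
        rw [← hyz _ (Finset.mem_union_left _ (Finset.mem_image_of_mem _ hm')),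
          ← hyz _ (Finset.mem_union_right _ (Finset.mem_image_of_mem _ hm'))]
        exact hy m hm
    · intro α hα hα' hg m _
      rw [← hα M m, ← hα' M m, hg]
    · refine le_trans ?_ hM.le
      refine le_trans ?_ (add_le_add le_rfl (add_le_add (herr γ) (herr γ')))
      refine le_trans (measure_mono ?_) ((measure_union_le _ _).trans
        (add_le_add le_rfl (measure_union_le _ _)))
      intro α hα
      by_cases hc1 : ∃ m, ¬ (f ((γ : K → K) α) m ↔ α ∈ b (a γ M m))
      · exact Or.inr (Or.inl (mem_iUnion.2 hc1))
      by_cases hc2 : ∃ m, ¬ (f ((γ' : K → K) α) m ↔ α ∈ b (a γ' M m))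
      · exact Or.inr (Or.inr (mem_iUnion.2 hc2))
      simp only [not_exists, not_not] at hc1 hc2
      left
      intro m hm
      rw [hc1 m, hc2 m]
      exact hα m hm

end

section
variable {K : Type u} [LinearOrder K] [MeasurableSpace K] [DiscreteMeasurableSpace K]
  {ν : Measure K} [IsProbabilityMeasure ν]

theorem AddM.atomless_case (h : AddM ν) {Ω : Type u} [MetricSpace Ω] [MeasurableSpace Ω] [BorelSpace Ω]
    (hcons : kNNUniversallyConsistent Ω) (e : K → Ω) {ε : ℝ} (hε : 0 < ε)
    (he : ∀ a b, a ≠ b → ε ≤ dist (e a) (e b))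
    (hna : ∀ B : Set K, ν B ≠ 0 → ∃ s, ν (B ∩ s) ≠ 0 ∧ ν (B \ s) ≠ 0) : False := by
  classical
  obtain ⟨f, hf⟩ := h.exists_inj hna
  have hinf : Infinite K := Cardinal.infinite_iff.2 h.aleph0_lt.le
  obtain ⟨z0⟩ : Nonempty K := inferInstance
  let D : Type := Σ n : ℕ, ℕ × Equiv.Perm (Fin n) × (Fin n → Bool)
  have hcard : #(D × List K) ≤ #K := by
    rw [mk_prod, Cardinal.mk_list_eq_mk, Cardinal.lift_id'.{0, u}]
    have hD : Cardinal.lift.{u} #D ≤ #K := by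
      have : Cardinal.lift.{u} #D ≤ ℵ₀ := by
        rw [Cardinal.lift_le_aleph0]
        exact Cardinal.mk_le_aleph0
      exact this.trans h.aleph0_lt.le
    exact (mul_le_mul' hD le_rfl).trans (Cardinal.mul_eq_self h.aleph0_lt.le).le
  obtain ⟨i⟩ := Cardinal.le_def _ _ |>.1 hcard
  have : Nonempty (D × List K) := ⟨(⟨0, 0, 1, fun _ => true⟩, [])⟩
  let S : D × List K → Set K := fun p =>
    {x | kNNLabel p.1.1 p.1.2.1 (fun j => (e (p.2.getD j z0), p.1.2.2.2 j)) p.1.2.2.1 (e x) = true}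
  refine h.gs f hf (fun a => S (Function.invFun i a)) fun C δ hδ => ?_
  obtain ⟨n, k, π, σ, hlt⟩ := sep_approx hcons ν e hε he (fun x => decide (x ∈ C)) δ hδ
  refine ⟨i (⟨n, k, π, fun j => decide (σ j ∈ C)⟩, List.ofFn σ), lt_of_le_of_lt (measure_mono ?_) hlt⟩
  intro x hx
  rw [mem_ofPred_eq, Function.leftInverse_invFun i.injective] at hx
  rw [mem_ofPred_eq]
  intro heq
  apply hx
  have h1 : ∀ j : Fin n, (List.ofFn σ).getD j z0 = σ j := by
    intro j
    simp
  simp only [S, mem_ofPred_eq, h1]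
  rw [heq, decide_eq_true_eq]

end

theorem density_lt_of_consistent {Ω : Type u} [MetricSpace Ω] (hc : kNNUniversallyConsistent Ω)
    (τ : Cardinal.{u}) (hτ : IsRealValuedMeasurableCardinal τ) : densityCard Ω < τ := by
  by_contra hle
  rw [not_lt] at hle
  obtain ⟨K, i1, i2, i3, ν, i4, hK, h⟩ := exists_addM hτ
  rw [← hK] at hle
  borelize Ω
  obtain ⟨e, ε, hε, he⟩ := h.exists_sep_inj hle
  by_cases hat : ∃ B : Set K, ν B ≠ 0 ∧ ∀ s : Set K, ν (B ∩ s) = 0 ∨ ν (B \ s) = 0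
  · obtain ⟨B, hB, hat⟩ := hat
    exact h.atom_case hc e hε he B hB hat
  · push Not at hat
    exact h.atomless_case hc e hε he hat

/-- **Theorem.** Let `Ω` be a metric space. The `k`-nearest neighbour classifier is
universally consistent in `Ω` if and only if it is universally consistent in every
separable metric subspace of `Ω` and the density of `Ω` is strictly less than every
real-valued measurable cardinal. -/
theorem kNN_universallyConsistent_iff_separable_subspaces_and_density_lt_rvm
    (Ω : Type u) [MetricSpace Ω] :
    kNNUniversallyConsistent Ω ↔
      ((∀ Y : Set Ω, TopologicalSpace.IsSeparable Y → kNNUniversallyConsistent Y) ∧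
        ∀ τ : Cardinal.{u}, IsRealValuedMeasurableCardinal τ → densityCard Ω < τ) := by
  constructor
  · intro hc
    exact ⟨fun Y hY => consistent_subspace hc Y hY, density_lt_of_consistent hc⟩
  · rintro ⟨hs, hd⟩
    borelize Ω
    exact consistent_of_support hs fun μ _ => exists_separable_support hd μ

end
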